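/- Let $c>0$ and $n>c$ be real numbers, and for $k\in\mathbb{N}$, $x\ge0$ set $p_{n,k}(x)=\frac{(n/c)_k}{k!}(cx)^k(1+cx)^{-n/c-k}$, where $(a)_k$ is the ascending Pochhammer symbol. Then for all $x,y\ge 0$, $\sum_{k=0}^{\infty}p_{n,k}(x)p_{n,k}(y) \;=\; \frac{1}{\pi}\int_0^1 \Big(\big(\sqrt{c^2xy}+\sqrt{(1+cx)(1+cy)}\big)^2-4t\sqrt{c^2xy(1+cx)(1+cy)}\Big)^{-n/c}\,\frac{dt}{\sqrt{t(1-t)}}$. -/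

import Mathlib

theorem ring_choose_add_sub_one (a : ℝ) (k : ℕ) :
    Ring.choose (a + k - 1) k = (ascPochhammer ℝ k).eval a / k.factorial := by
  rw [eq_div_iff (by positivity), mul_comm, ← nsmul_eq_mul,
    ← Ring.descPochhammer_eq_factorial_smul_choose,
    Polynomial.descPochhammer_smeval_eq_ascPochhammer,
    Polynomial.ascPochhammer_smeval_eq_eval]
  congr 1
  ring

theorem hasSum_complex_one_sub_cpow_neg (a : ℝ) {z : ℂ} (hz : ‖z‖ < 1) :
    HasSum (fun k : ℕ ↦ (((ascPochhammer ℝ k).eval a / k.factorial : ℝ) : ℂ) * z ^ k)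
      ((1 - z) ^ (-a : ℂ)) := by
  have h := (Complex.one_div_one_sub_cpow_hasFPowerSeriesOnBall_zero a).hasSum (y := z)
    (by simpa [enorm_eq_nnnorm] using! hz)
  simp only [← ring_choose_add_sub_one, Complex.ofReal_choose]
  simpa [Complex.cpow_neg, mul_comm] using h

theorem summable_abs_ascPochhammer_mul_pow (a : ℝ) {q : ℝ} (hq : |q| < 1) :
    Summable fun k : ℕ ↦ |(ascPochhammer ℝ k).eval a / k.factorial * q ^ k| := by
  have h := Real.one_div_one_sub_rpow_hasFPowerSeriesOnBall_zero a
  have hs := FormalMultilinearSeries.summable_norm_apply _ (x := q)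
    (Metric.eball_subset_eball h.r_le (by simpa [enorm_eq_nnnorm] using! hq))
  simp only [← ring_choose_add_sub_one]
  simpa [mul_comm, abs_mul] using hs

theorem integral_exp_int_mul_I (m : ℤ) :
    ∫ θ in (-Real.pi)..Real.pi, Complex.exp (m * Complex.I * θ) =
      if m = 0 then (2 * Real.pi : ℂ) else 0 := by
  split_ifs with h
  · simp only [h, Int.cast_zero, zero_mul, Complex.exp_zero, intervalIntegral.integral_const,
      Complex.real_smul]
    push_cast
    ring
  · have hm : (m * Complex.I : ℂ) ≠ 0 := by simp [h]
    rw [integral_exp_mul_complex hm, div_eq_zero_iff, sub_eq_zero]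
    refine Or.inl (Complex.exp_eq_exp_iff_exists_int.2 ⟨m, ?_⟩)
    push_cast
    ring

/-- Parseval's identity for an absolutely convergent power series on the unit circle. -/
theorem hasSum_sq_integral_normSq {b : ℕ → ℝ} (hb : Summable fun k ↦ |b k|) {F : ℝ → ℂ}
    (hF : ∀ θ : ℝ, HasSum (fun k : ℕ ↦ (b k : ℂ) * Complex.exp (θ * Complex.I) ^ k) (F θ)) :
    HasSum (fun k ↦ 2 * Real.pi * b k ^ 2)
      (∫ θ in (-Real.pi)..Real.pi, Complex.normSq (F θ)) := by
  have hnorm (θ : ℝ) (k : ℕ) :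
      ‖(b k : ℂ) * Complex.exp (θ * Complex.I) ^ k‖ = |b k| := by
    simp [Complex.norm_exp_ofReal_mul_I]
  have hprod (θ : ℝ) : HasSum (fun p : ℕ × ℕ ↦
      ((b p.1 : ℂ) * Complex.exp (θ * Complex.I) ^ p.1) *
        (starRingEnd ℂ) ((b p.2 : ℂ) * Complex.exp (θ * Complex.I) ^ p.2))
      (Complex.normSq (F θ)) := by
    rw [← Complex.mul_conj]
    have hconj : HasSum
        (fun k ↦ (starRingEnd ℂ) ((b k : ℂ) * Complex.exp (θ * Complex.I) ^ k))
        ((starRingEnd ℂ) (F θ)) :=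
      (hF θ).map (starRingEnd ℂ) Complex.continuous_conj
    have hs := summable_mul_of_summable_norm
      (f := fun k ↦ (b k : ℂ) * Complex.exp (θ * Complex.I) ^ k)
      (g := fun k ↦ (starRingEnd ℂ) ((b k : ℂ) * Complex.exp (θ * Complex.I) ^ k))
      (by simpa only [hnorm] using hb) (by simpa only [RCLike.norm_conj, hnorm] using hb)
    rw [← hconj.tsum_eq, ← (hF θ).tsum_eq, tsum_mul_tsum_of_summable_norm
      (by simpa only [hnorm] using hb) (by simpa only [RCLike.norm_conj, hnorm] using hb)]
    exact hs.hasSum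
  have hterm (θ : ℝ) (p : ℕ × ℕ) :
      ((b p.1 : ℂ) * Complex.exp (θ * Complex.I) ^ p.1) *
        (starRingEnd ℂ) ((b p.2 : ℂ) * Complex.exp (θ * Complex.I) ^ p.2) =
      ((b p.1 * b p.2 : ℝ) : ℂ) *
        Complex.exp (((p.1 - p.2 : ℤ) : ℂ) * Complex.I * θ) := by
    simp only [map_mul, Complex.conj_ofReal, map_natCast, ← Complex.exp_conj, Complex.conj_I,
      ← Complex.exp_nat_mul]
    rw [mul_mul_mul_comm, ← Complex.exp_add]
    push_cast
    congr 2
    ring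
  have hint := intervalIntegral.hasSum_integral_of_dominated_convergence
    (μ := MeasureTheory.volume) (a := -Real.pi) (b := Real.pi)
    (fun (p : ℕ × ℕ) (_ : ℝ) ↦ |b p.1| * |b p.2|)
    (fun p ↦ Continuous.aestronglyMeasurable (by fun_prop))
    (fun p ↦ Filter.Eventually.of_forall fun θ _ ↦ by
      rw [norm_mul, RCLike.norm_conj, hnorm, hnorm])
    (Filter.Eventually.of_forall fun _ _ ↦ hb.mul_of_nonneg hb (fun _ ↦ abs_nonneg _)
      (fun _ ↦ abs_nonneg _))
    intervalIntegrable_const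
    (Filter.Eventually.of_forall fun θ _ ↦ hprod θ)
  simp only [hterm, intervalIntegral.integral_const_mul, integral_exp_int_mul_I,
    intervalIntegral.integral_ofReal] at hint
  have hinj : Function.Injective fun k : ℕ ↦ (k, k) := fun _ _ h ↦ (Prod.ext_iff.1 h).1
  rw [← hinj.hasSum_iff] at hint
  · rw [← Complex.hasSum_ofReal]
    have hdiag : (fun k ↦ ((2 * Real.pi * b k ^ 2 : ℝ) : ℂ)) =
        (fun p : ℕ × ℕ ↦ ((b p.1 * b p.2 : ℝ) : ℂ) *
          if (p.1 - p.2 : ℤ) = 0 then (2 * Real.pi : ℂ) else 0) ∘ fun k ↦ (k, k) := by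
      ext k
      simp
      ring
    rw [hdiag]
    exact hint
  · rintro ⟨i, j⟩ hij
    have : (i - j : ℤ) ≠ 0 := fun h ↦ hij ⟨i, by simp; omega⟩
    simp [this]

/-- The substitution `t = (1 + cos θ) / 2`. -/
theorem integral_div_sqrt_mul_one_sub (f : ℝ → ℝ) :
    ∫ t in (0 : ℝ)..1, f t / √(t * (1 - t)) =
      ∫ θ in (0 : ℝ)..Real.pi, f ((1 + Real.cos θ) / 2) := by
  rw [← Polynomial.Chebyshev.integral_measureT_eq_integral_cos (f := fun x ↦ f ((1 + x) / 2)),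
    Polynomial.Chebyshev.integral_measureT]
  have h := intervalIntegral.integral_comp_mul_add (a := -1) (b := 1)
    (fun t ↦ f t / √(t * (1 - t))) (c := 1 / 2) (by norm_num) (1 / 2)
  norm_num at h
  rw [← mul_right_inj' (two_ne_zero' ℝ), ← h, ← intervalIntegral.integral_const_mul]
  congr 1 with x
  have : √((1 / 2 * x + 1 / 2) * (1 - (1 / 2 * x + 1 / 2))) = √(1 - x ^ 2) / 2 := by
    rw [show (1 / 2 * x + 1 / 2) * (1 - (1 / 2 * x + 1 / 2)) = (1 - x ^ 2) / 2 ^ 2 by ring,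
      Real.sqrt_div' _ (by norm_num), Real.sqrt_sq (by norm_num)]
  rw [this, Real.sqrt_inv, show 1 / 2 * x + 1 / 2 = (1 + x) / 2 by ring, div_div_eq_mul_div,
    div_eq_mul_inv]
  ring

theorem integral_neg_self_of_even {f : ℝ → ℝ} (hf : ∀ x, f (-x) = f x) (hc : Continuous f) (b : ℝ) :
    ∫ x in (-b)..b, f x = 2 * ∫ x in (0 : ℝ)..b, f x := by
  have h := intervalIntegral.integral_comp_neg (a := 0) (b := b) f
  simp only [hf, neg_zero] at h
  rw [← intervalIntegral.integral_add_adjacent_intervals (hc.intervalIntegrable _ 0)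
    (hc.intervalIntegrable _ _), ← h]
  ring

theorem normSq_one_sub_mul_exp (q θ : ℝ) :
    Complex.normSq (1 - q * Complex.exp (θ * Complex.I)) = 1 + q ^ 2 - 2 * q * Real.cos θ := by
  rw [Complex.normSq_apply]
  simp [Complex.exp_ofReal_mul_I_re, Complex.exp_ofReal_mul_I_im]
  linear_combination q ^ 2 * Real.sin_sq_add_cos_sq θ

theorem one_add_sq_sub_two_mul_cos_pos {q : ℝ} (hq : |q| < 1) (θ : ℝ) :
    0 < 1 + q ^ 2 - 2 * q * Real.cos θ := by
  have h : |q * Real.cos θ| ≤ |q| := by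
    rw [abs_mul]
    exact mul_le_of_le_one_right (abs_nonneg q) (Real.abs_cos_le_one θ)
  nlinarith [le_abs_self (q * Real.cos θ), sq_abs q, sq_pos_of_pos (sub_pos.2 hq)]

theorem hasSum_sq_ascPochhammer_mul_pow (a : ℝ) {q : ℝ} (hq : |q| < 1) :
    HasSum (fun k : ℕ ↦ ((ascPochhammer ℝ k).eval a / k.factorial * q ^ k) ^ 2)
      (1 / Real.pi * ∫ θ in (0 : ℝ)..Real.pi, (1 + q ^ 2 - 2 * q * Real.cos θ) ^ (-a)) := by
  have h := hasSum_sq_integral_normSq (summable_abs_ascPochhammer_mul_pow a hq)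
    (F := fun θ ↦ (1 - q * Complex.exp (θ * Complex.I)) ^ (-a : ℂ)) fun θ ↦ by
      have := hasSum_complex_one_sub_cpow_neg a (z := q * Complex.exp (θ * Complex.I))
        (by simpa [Complex.norm_exp_ofReal_mul_I] using hq)
      simpa [mul_pow, mul_assoc] using this
  have hn (θ : ℝ) : Complex.normSq ((1 - q * Complex.exp (θ * Complex.I)) ^ (-a : ℂ)) =
      (1 + q ^ 2 - 2 * q * Real.cos θ) ^ (-a) := by
    rw [← normSq_one_sub_mul_exp, Complex.normSq_eq_norm_sq, Complex.normSq_eq_norm_sq,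
      ← Complex.ofReal_neg, Complex.norm_cpow_real, Real.rpow_pow_comm (norm_nonneg _)]
  have hcont : Continuous fun θ ↦ (1 + q ^ 2 - 2 * q * Real.cos θ) ^ (-a) :=
    Continuous.rpow_const (by fun_prop) fun θ ↦ Or.inl (one_add_sq_sub_two_mul_cos_pos hq θ).ne'
  simp only [hn] at h
  rw [integral_neg_self_of_even (by simp) hcont] at h
  have hscale (s : ℝ) : 1 / (2 * Real.pi) * (2 * Real.pi * s) = s := by
    field_simp
  have hdiv := h.mul_left (1 / (2 * Real.pi))
  simp only [hscale] at hdiv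
  rwa [← mul_assoc, one_div_mul_eq_div, mul_comm 2 Real.pi, ← div_div,
    div_right_comm, div_self two_ne_zero] at hdiv

/-- For `c > 0`, `n > c`, the kernel `∑ p_{n,k}(x) p_{n,k}(y)` has the integral
representation (2.4). -/
theorem stmt_1 (c n : ℝ) (hc : 0 < c) (hn : c < n) (x y : ℝ) (hx : 0 ≤ x) (hy : 0 ≤ y) :
    (∑' k : ℕ,
      ((ascPochhammer ℝ k).eval (n / c) / (k.factorial : ℝ) * (c * x) ^ k *
          (1 + c * x) ^ (-(n / c) - (k : ℝ))) *
      ((ascPochhammer ℝ k).eval (n / c) / (k.factorial : ℝ) * (c * y) ^ k *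
          (1 + c * y) ^ (-(n / c) - (k : ℝ)))) =
    (1 / Real.pi) * ∫ t in (0:ℝ)..1,
      ((Real.sqrt (c ^ 2 * x * y) + Real.sqrt ((1 + c * x) * (1 + c * y))) ^ 2 -
          4 * t * Real.sqrt (c ^ 2 * x * y * (1 + c * x) * (1 + c * y))) ^ (-(n / c)) /
        Real.sqrt (t * (1 - t)) := by
  set a := n / c
  have hX : 0 < 1 + c * x := by positivity
  have hY : 0 < 1 + c * y := by positivity
  rw [mul_assoc (c ^ 2 * x * y), Real.sqrt_mul (by positivity : 0 ≤ c ^ 2 * x * y)]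
  have hu2 : √(c ^ 2 * x * y) ^ 2 = c ^ 2 * x * y := Real.sq_sqrt (by positivity)
  have hv2 : √((1 + c * x) * (1 + c * y)) ^ 2 = (1 + c * x) * (1 + c * y) :=
    Real.sq_sqrt (by positivity)
  have hu : 0 ≤ √(c ^ 2 * x * y) := Real.sqrt_nonneg _
  have hv : 0 < √((1 + c * x) * (1 + c * y)) := Real.sqrt_pos.2 (by positivity)
  generalize √(c ^ 2 * x * y) = u at *
  generalize √((1 + c * x) * (1 + c * y)) = v at *
  have hq : |u / v| < 1 := by
    rw [abs_of_nonneg (by positivity), div_lt_one hv]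
    refine lt_of_pow_lt_pow_left₀ 2 hv.le ?_
    nlinarith [mul_nonneg hc.le hx, mul_nonneg hc.le hy]
  rw [integral_div_sqrt_mul_one_sub (fun t ↦ ((u + v) ^ 2 - 4 * t * (u * v)) ^ (-a))]
  have hbase (θ : ℝ) : ((u + v) ^ 2 - 4 * ((1 + Real.cos θ) / 2) * (u * v)) ^ (-a) =
      (v ^ 2) ^ (-a) * (1 + (u / v) ^ 2 - 2 * (u / v) * Real.cos θ) ^ (-a) := by
    rw [← Real.mul_rpow (by positivity) (one_add_sq_sub_two_mul_cos_pos hq θ).le]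
    congr 1
    field_simp
    ring
  simp only [hbase, intervalIntegral.integral_const_mul]
  rw [mul_left_comm]
  refine (tsum_congr fun k ↦ ?_).trans
    ((hasSum_sq_ascPochhammer_mul_pow a hq).mul_left ((v ^ 2) ^ (-a))).tsum_eq
  have hqk : ((u / v) ^ k) ^ 2 =
      (c * x) ^ k * (c * y) ^ k / ((1 + c * x) ^ k * (1 + c * y) ^ k) := by
    rw [pow_right_comm, div_pow, hu2, hv2, ← mul_pow, ← mul_pow, ← div_pow]
    ring_nf
  rw [Real.rpow_sub_natCast hX.ne', Real.rpow_sub_natCast hY.ne', hv2,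
    Real.mul_rpow hX.le hY.le, mul_pow _ ((u / v) ^ k), hqk]
  field_simp
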